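/- Let p be a log-concave probability density on ℝ^d with mean μ and covariance matrix A, and let B and C be positive semi-definite d×d real matrices. Then ‖ ∫ B^{1/2}(x−μ)(x−μ)ᵀC(x−μ) p(x) dx ‖₂ ≤ 16 · ‖A^{1/2} B A^{1/2}‖₂^{1/2} · tr( A^{1/2} C A^{1/2} ). -/

import Mathlib

open MeasureTheory Filter Matrix

noncomputable section

/-- Mass of a set under a density. -/
def setMass {d : ℕ} (p : EuclideanSpace ℝ (Fin d) → ℝ) (S : Set (EuclideanSpace ℝ (Fin d))) : ℝ :=
  ∫ x in S, p x

/-- `p` is a log-concave probability density on `ℝ^d`. -/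
def IsLogConcaveDensity {d : ℕ} (p : EuclideanSpace ℝ (Fin d) → ℝ) : Prop :=
  (∀ x, 0 ≤ p x) ∧ (∫ x, p x = 1) ∧
    ∀ x y : EuclideanSpace ℝ (Fin d), ∀ t : ℝ, t ∈ Set.Icc (0:ℝ) 1 →
      p (t • x + (1 - t) • y) ≥ p x ^ t * p y ^ (1 - t)

/-- Boundary measure `p⁺(∂S)`. -/
def boundaryMeasure {d : ℕ} (p : EuclideanSpace ℝ (Fin d) → ℝ)
    (S : Set (EuclideanSpace ℝ (Fin d))) : ℝ :=
  Filter.liminf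
    (fun ε : ℝ => (setMass p {x | Metric.infDist x S ≤ ε} - setMass p S) / ε)
    (nhdsWithin 0 (Set.Ioi 0))

/-- Isoperimetric coefficient. -/
def isoperiCoeff {d : ℕ} (p : EuclideanSpace ℝ (Fin d) → ℝ) : ℝ :=
  sInf { r | ∃ S : Set (EuclideanSpace ℝ (Fin d)), MeasurableSet S ∧
    0 < setMass p S ∧ setMass p S < 1 ∧
    r = boundaryMeasure p S / min (setMass p S) (setMass p Sᶜ) }

/-- Mean of a density. -/
def densMean {d : ℕ} (p : EuclideanSpace ℝ (Fin d) → ℝ) : EuclideanSpace ℝ (Fin d) :=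
  ∫ x, p x • x

/-- Covariance matrix of a density. -/
def covMatrix {d : ℕ} (p : EuclideanSpace ℝ (Fin d) → ℝ) : Matrix (Fin d) (Fin d) ℝ :=
  Matrix.of fun i j => ∫ x, p x * ((x i - densMean p i) * (x j - densMean p j))

/-- Spectral norm of a matrix. -/
def specNorm {d : ℕ} (A : Matrix (Fin d) (Fin d) ℝ) : ℝ :=
  ‖Matrix.toEuclideanCLM (𝕜 := ℝ) A‖

/-- The KLS infimum constant over dimension `k`. -/
def psiDim (k : ℕ) : ℝ :=
  sInf { r | ∃ p : EuclideanSpace ℝ (Fin k) → ℝ, IsLogConcaveDensity p ∧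
    HasCompactSupport p ∧ r = isoperiCoeff p * Real.sqrt (specNorm (covMatrix p)) }

/-- Real power of a symmetric matrix through its spectral decomposition. -/
def matRpow {d : ℕ} (A : Matrix (Fin d) (Fin d) ℝ) (r : ℝ) : Matrix (Fin d) (Fin d) ℝ :=
  if hA : A.IsHermitian then
    (hA.eigenvectorUnitary : Matrix (Fin d) (Fin d) ℝ) *
      Matrix.diagonal (fun i => hA.eigenvalues i ^ r) *
      (star (hA.eigenvectorUnitary : Matrix (Fin d) (Fin d) ℝ))
  else 0

/-- The 3-tensor `T_p(A,B,C)` of a density. -/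
def ttensor {d : ℕ} (p : EuclideanSpace ℝ (Fin d) → ℝ)
    (A B C : Matrix (Fin d) (Fin d) ℝ) : ℝ :=
  ∫ x : EuclideanSpace ℝ (Fin d), ∫ y : EuclideanSpace ℝ (Fin d),
    p x * p y *
      (((fun i => x i - densMean p i) ⬝ᵥ A.mulVec (fun i => y i - densMean p i)) *
       ((fun i => x i - densMean p i) ⬝ᵥ B.mulVec (fun i => y i - densMean p i)) *
       ((fun i => x i - densMean p i) ⬝ᵥ C.mulVec (fun i => y i - densMean p i)))

/-- `p` is more log-concave than `N(0, τ⁻¹ I_d)`. -/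
def IsMoreLogConcaveThanGauss {d : ℕ} (τ : ℝ) (p : EuclideanSpace ℝ (Fin d) → ℝ) : Prop :=
  (∀ x, 0 ≤ p x) ∧ (∫ x, p x = 1) ∧
    ∀ x y : EuclideanSpace ℝ (Fin d), ∀ t : ℝ, t ∈ Set.Icc (0:ℝ) 1 →
      p (t • x + (1 - t) • y) * Real.exp (τ * ‖t • x + (1 - t) • y‖ ^ 2 / 2) ≥
        (p x * Real.exp (τ * ‖x‖ ^ 2 / 2)) ^ t *
        (p y * Real.exp (τ * ‖y‖ ^ 2 / 2)) ^ (1 - t)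

end

open scoped ENNReal

/-- Log-concavity of an extended nonnegative function on a real vector space. -/
def ENNLogConcave {E : Type*} [AddCommGroup E] [Module ℝ E] (f : E → ℝ≥0∞) : Prop :=
  ∀ x y : E, ∀ a b : ℝ, 0 < a → 0 < b → a + b = 1 → f x ^ a * f y ^ b ≤ f (a • x + b • y)

theorem ENNReal.min_le_rpow_mul_rpow (u v : ℝ≥0∞) {a b : ℝ} (ha : 0 < a) (hb : 0 < b)
    (hab : a + b = 1) : min u v ≤ u ^ a * v ^ b := by
  calc min u v = min u v ^ a * min u v ^ b := by
        rw [← ENNReal.rpow_add_of_nonneg _ _ ha.le hb.le, hab, ENNReal.rpow_one]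
    _ ≤ u ^ a * v ^ b := by
        gcongr
        · exact min_le_left _ _
        · exact min_le_right _ _

theorem ENNReal.geom_mean_le_arith_mean2_weighted (u v : ℝ≥0∞) {a b : ℝ} (ha : 0 < a)
    (hb : 0 < b) (hab : a + b = 1) :
    u ^ a * v ^ b ≤ ENNReal.ofReal a * u + ENNReal.ofReal b * v := by
  have hpq : (a⁻¹).HolderConjugate b⁻¹ := by
    rw [Real.holderConjugate_iff]
    refine ⟨(one_lt_inv₀ ha).2 (by linarith), by simpa using hab⟩
  refine (ENNReal.young_inequality (u ^ a) (v ^ b) hpq).trans_eq ?_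
  rw [← ENNReal.rpow_mul, ← ENNReal.rpow_mul, mul_inv_cancel₀ ha.ne', mul_inv_cancel₀ hb.ne',
    ENNReal.rpow_one, ENNReal.rpow_one, ENNReal.ofReal_inv_of_pos ha, ENNReal.ofReal_inv_of_pos hb,
    div_eq_mul_inv, div_eq_mul_inv, inv_inv, inv_inv, mul_comm u, mul_comm v]

namespace ENNLogConcave

theorem convex_superlevel {E : Type*} [AddCommGroup E] [Module ℝ E] {f : E → ℝ≥0∞}
    (hf : ENNLogConcave f) (t : ℝ≥0∞) : Convex ℝ {x | t < f x} := by
  rw [convex_iff_forall_pos]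
  intro x hx y hy a b ha hb hab
  exact (lt_min hx hy).trans_le
    ((ENNReal.min_le_rpow_mul_rpow _ _ ha hb hab).trans (hf x y a b ha hb hab))

theorem aemeasurable {E : Type*} [NormedAddCommGroup E] [NormedSpace ℝ E] [MeasurableSpace E]
    [BorelSpace E] [FiniteDimensional ℝ E] {μ : Measure E} [μ.IsAddHaarMeasure] {f : E → ℝ≥0∞}
    (hf : ENNLogConcave f) : AEMeasurable f μ := by
  apply NullMeasurable.aemeasurable
  exact measurable_of_Ioi (α := ℝ≥0∞) (δ := NullMeasurableSpace E μ)
    fun t => (hf.convex_superlevel t).nullMeasurableSet μ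

theorem comp_affine {E F : Type*} [AddCommGroup E] [Module ℝ E] [AddCommGroup F] [Module ℝ F]
    {f : F → ℝ≥0∞} (hf : ENNLogConcave f) (g : E → F)
    (hg : ∀ x y : E, ∀ a b : ℝ, a + b = 1 → g (a • x + b • y) = a • g x + b • g y) :
    ENNLogConcave fun x => f (g x) := by
  intro x y a b ha hb hab
  simp only [hg x y a b hab]
  exact hf _ _ a b ha hb hab

end ENNLogConcave

theorem volume_combination_le {I J K : Set ℝ} (hI : I.Nonempty) (hJ : J.Nonempty)
    (hIc : Convex ℝ I) (hJc : Convex ℝ J) {a b : ℝ} (ha : 0 < a) (hb : 0 < b)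
    (hK : ∀ x ∈ I, ∀ y ∈ J, a * x + b * y ∈ K) :
    ENNReal.ofReal a * volume I + ENNReal.ofReal b * volume J ≤ volume K := by
  have key : ∀ i₁ ∈ I, ∀ i₂ ∈ I, ∀ j₁ ∈ J, ∀ j₂ ∈ J,
      ENNReal.ofReal a * edist i₁ i₂ + ENNReal.ofReal b * edist j₁ j₂ ≤ volume K := by
    intro i₁ hi₁ i₂ hi₂ j₁ hj₁ j₂ hj₂
    wlog hi : i₁ ≤ i₂ generalizing i₁ i₂
    · rw [edist_comm i₁]
      exact this i₂ hi₂ i₁ hi₁ (le_of_not_ge hi)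
    wlog hj : j₁ ≤ j₂ generalizing j₁ j₂
    · rw [edist_comm j₁]
      exact this j₂ hj₂ j₁ hj₁ (le_of_not_ge hj)
    have hsub : Set.Icc (a * i₁ + b * j₁) (a * i₂ + b * j₂) ⊆ K := by
      have hc : Continuous fun t : ℝ =>
          a * (i₁ + t * (i₂ - i₁)) + b * (j₁ + t * (j₂ - j₁)) := by fun_prop
      intro z hz
      have hz' : z ∈ Set.Icc (a * (i₁ + 0 * (i₂ - i₁)) + b * (j₁ + 0 * (j₂ - j₁)))
          (a * (i₁ + 1 * (i₂ - i₁)) + b * (j₁ + 1 * (j₂ - j₁))) := by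
        constructor
        · have := hz.1
          linarith
        · have := hz.2
          linarith
      obtain ⟨t, ht, rfl⟩ := intermediate_value_Icc (zero_le_one' ℝ) hc.continuousOn hz'
      refine hK _ ?_ _ ?_
      · exact hIc.add_smul_sub_mem hi₁ hi₂ ht
      · exact hJc.add_smul_sub_mem hj₁ hj₂ ht
    refine le_trans (le_of_eq ?_) (measure_mono hsub)
    rw [Real.volume_Icc, edist_comm i₁, edist_comm j₁, edist_dist, edist_dist, Real.dist_eq,
      Real.dist_eq, abs_of_nonneg (sub_nonneg.2 hi), abs_of_nonneg (sub_nonneg.2 hj),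
      ← ENNReal.ofReal_mul ha.le, ← ENNReal.ofReal_mul hb.le, ← ENNReal.ofReal_add]
    · congr 1
      ring
    · exact mul_nonneg ha.le (sub_nonneg.2 hi)
    · exact mul_nonneg hb.le (sub_nonneg.2 hj)
  have : Nonempty I := hI.to_subtype
  have : Nonempty J := hJ.to_subtype
  calc ENNReal.ofReal a * volume I + ENNReal.ofReal b * volume J
      ≤ ENNReal.ofReal a * (⨆ q : I × I, edist q.1.1 q.2.1)
        + ENNReal.ofReal b * (⨆ q : J × J, edist q.1.1 q.2.1) := by
        gcongr
        · refine (Real.volume_le_diam I).trans (Metric.ediam_le fun x hx y hy => ?_)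
          exact le_iSup (fun q : I × I => edist q.1.1 q.2.1) (⟨x, hx⟩, ⟨y, hy⟩)
        · refine (Real.volume_le_diam J).trans (Metric.ediam_le fun x hx y hy => ?_)
          exact le_iSup (fun q : J × J => edist q.1.1 q.2.1) (⟨x, hx⟩, ⟨y, hy⟩)
    _ ≤ volume K := by
        rw [ENNReal.mul_iSup, ENNReal.mul_iSup]
        exact ENNReal.iSup_add_iSup_le fun q r =>
          key _ q.1.2 _ q.2.2 _ r.1.2 _ r.2.2

theorem lintegral_eq_lintegral_meas_lt_of_le_one {f : ℝ → ℝ≥0∞} (hf : AEMeasurable f)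
    (h1 : ∀ x, f x ≤ 1) :
    ∫⁻ x, f x = ∫⁻ t in Set.Ioi (0 : ℝ), volume {x | ENNReal.ofReal t < f x} := by
  have hlt : ∀ x, f x ≠ ∞ := fun x => ((h1 x).trans_lt ENNReal.one_lt_top).ne
  have h := lintegral_eq_lintegral_meas_lt volume (f := fun x => (f x).toReal)
    (ae_of_all _ fun x => ENNReal.toReal_nonneg) hf.ennreal_toReal
  simp only [ENNReal.ofReal_toReal (hlt _)] at h
  rw [h]
  refine setLIntegral_congr_fun measurableSet_Ioi fun t ht => ?_
  simp only [ENNReal.ofReal_lt_iff_lt_toReal (le_of_lt ht) (hlt _)]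

theorem lintegral_combination_le {f g h : ℝ → ℝ≥0∞} (hfm : AEMeasurable f) (hgm : AEMeasurable g)
    (hhm : AEMeasurable h) (hf1 : ∀ x, f x ≤ 1) (hg1 : ∀ x, g x ≤ 1) (hh1 : ∀ x, h x ≤ 1)
    (hf : ∀ t, Convex ℝ {x | t < f x}) (hg : ∀ t, Convex ℝ {x | t < g x})
    (hfs : ∀ t < 1, ∃ x, t < f x) (hgs : ∀ t < 1, ∃ x, t < g x) {a b : ℝ} (ha : 0 < a)
    (hb : 0 < b) (hfg : ∀ x y, min (f x) (g y) ≤ h (a * x + b * y)) :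
    ENNReal.ofReal a * (∫⁻ x, f x) + ENNReal.ofReal b * (∫⁻ x, g x) ≤ ∫⁻ x, h x := by
  rw [lintegral_eq_lintegral_meas_lt_of_le_one hfm hf1,
    lintegral_eq_lintegral_meas_lt_of_le_one hgm hg1,
    lintegral_eq_lintegral_meas_lt_of_le_one hhm hh1]
  refine (add_le_add (lintegral_const_mul_le _ _) (lintegral_const_mul_le _ _)).trans ?_
  refine (le_lintegral_add _ _).trans (lintegral_mono fun t => ?_)
  rcases lt_or_ge (ENNReal.ofReal t) 1 with ht | ht
  · exact volume_combination_le (hfs _ ht) (hgs _ ht) (hf _) (hg _) ha hb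
      fun x hx y hy => (lt_min hx hy).trans_le (hfg x y)
  · have e1 : {x | ENNReal.ofReal t < f x} = ∅ :=
      Set.eq_empty_of_forall_notMem fun x hx => absurd (hf1 x) (not_le.2 (ht.trans_lt hx))
    have e2 : {x | ENNReal.ofReal t < g x} = ∅ :=
      Set.eq_empty_of_forall_notMem fun x hx => absurd (hg1 x) (not_le.2 (ht.trans_lt hx))
    simp [e1, e2]

theorem min_div_iSup_le_one (f : ℝ → ℝ≥0∞) (c : ℝ≥0∞) (x : ℝ) :
    min (f x) c / min (⨆ x, f x) c ≤ 1 :=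
  ENNReal.div_le_of_le_mul (by
    rw [one_mul]
    exact min_le_min_right _ (le_iSup f x))

theorem exists_lt_min_div_iSup {f : ℝ → ℝ≥0∞} {c : ℝ≥0∞} (hM : min (⨆ x, f x) c ≠ 0)
    (hc : c ≠ ∞) {t : ℝ≥0∞} (ht : t < 1) : ∃ x, t < min (f x) c / min (⨆ x, f x) c := by
  have hM' : min (⨆ x, f x) c ≠ ∞ := ((min_le_right _ _).trans_lt hc.lt_top).ne
  have h1 : t * min (⨆ x, f x) c < min (⨆ x, f x) c := by
    calc t * min (⨆ x, f x) c < 1 * min (⨆ x, f x) c :=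
          (ENNReal.mul_lt_mul_iff_left hM hM').2 ht
      _ = _ := one_mul _
  obtain ⟨x, hx⟩ := lt_iSup_iff.1 (h1.trans_le (min_le_left _ _))
  refine ⟨x, ?_⟩
  rw [ENNReal.lt_div_iff_mul_lt (Or.inl hM) (Or.inl hM')]
  exact lt_min hx (h1.trans_le (min_le_right _ _))

theorem convex_superlevel_min_div {f : ℝ → ℝ≥0∞} (hf : ENNLogConcave f) {c M : ℝ≥0∞}
    (hM : M ≠ 0) (hM' : M ≠ ∞) (t : ℝ≥0∞) : Convex ℝ {x | t < min (f x) c / M} := by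
  have : {x | t < min (f x) c / M} = {x | t * M < f x} ∩ {_x | t * M < c} := by
    ext x
    simp only [ENNReal.lt_div_iff_mul_lt (Or.inl hM) (Or.inl hM'), lt_min_iff, Set.mem_ofPred_eq,
      Set.mem_inter_iff]
  rw [this]
  refine (hf.convex_superlevel _).inter ?_
  by_cases h : t * M < c
  · simp [h, convex_univ]
  · simp [h, convex_empty]

theorem prekopa_leindler_truncated {f g h : ℝ → ℝ≥0∞} (hf : ENNLogConcave f)
    (hg : ENNLogConcave g) (hh : ENNLogConcave h) {a b : ℝ} (ha : 0 < a) (hb : 0 < b)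
    (hab : a + b = 1) (hfg : ∀ x y, f x ^ a * g y ^ b ≤ h (a * x + b * y)) {c : ℝ≥0∞}
    (hc : c ≠ ∞) :
    (∫⁻ x, min (f x) c) ^ a * (∫⁻ x, min (g x) c) ^ b ≤ ∫⁻ x, h x := by
  set M := min (⨆ x, f x) c with hMdef
  set N := min (⨆ x, g x) c with hNdef
  have hM' : M ≠ ∞ := ((min_le_right _ _).trans_lt hc.lt_top).ne
  have hN' : N ≠ ∞ := ((min_le_right _ _).trans_lt hc.lt_top).ne
  by_cases hM : M = 0
  · have : ∀ x, min (f x) c = 0 := fun x =>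
      le_antisymm ((min_le_min_right c (le_iSup f x)).trans_eq hM) zero_le
    simp [this, ENNReal.zero_rpow_of_pos ha]
  by_cases hN : N = 0
  · have : ∀ x, min (g x) c = 0 := fun x =>
      le_antisymm ((min_le_min_right c (le_iSup g x)).trans_eq hN) zero_le
    simp [this, ENNReal.zero_rpow_of_pos hb]
  set γ := M ^ a * N ^ b with hγ
  have hγ0 : γ ≠ 0 := mul_ne_zero (by simp [hM, hM', ENNReal.rpow_eq_zero_iff])
    (by simp [hN, hN', ENNReal.rpow_eq_zero_iff])
  have hγ' : γ ≠ ∞ := ENNReal.mul_ne_top (ENNReal.rpow_ne_top_of_nonneg ha.le hM')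
    (ENNReal.rpow_ne_top_of_nonneg hb.le hN')
  have hcomb := lintegral_combination_le (f := fun x => min (f x) c / M)
    (g := fun x => min (g x) c / N) (h := fun x => min (h x / γ) 1)
    ((hf.aemeasurable.min aemeasurable_const).div_const _)
    ((hg.aemeasurable.min aemeasurable_const).div_const _)
    ((hh.aemeasurable.div_const _).min aemeasurable_const)
    (min_div_iSup_le_one f c) (min_div_iSup_le_one g c) (fun x => min_le_right _ _)
    (convex_superlevel_min_div hf hM hM') (convex_superlevel_min_div hg hN hN')
    (fun t ht => exists_lt_min_div_iSup hM hc ht) (fun t ht => exists_lt_min_div_iSup hN hc ht)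
    ha hb (fun x y => by
      refine le_min ?_ ((min_le_left _ _).trans (min_div_iSup_le_one f c x))
      refine (ENNReal.min_le_rpow_mul_rpow _ _ ha hb hab).trans ?_
      rw [ENNReal.div_rpow_of_nonneg _ _ ha.le, ENNReal.div_rpow_of_nonneg _ _ hb.le,
        ENNReal.le_div_iff_mul_le (Or.inl hγ0) (Or.inl hγ'), hγ]
      calc min (f x) c ^ a / M ^ a * (min (g y) c ^ b / N ^ b) * (M ^ a * N ^ b)
          = (min (f x) c ^ a / M ^ a * M ^ a) * (min (g y) c ^ b / N ^ b * N ^ b) := by ring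
        _ ≤ f x ^ a * g y ^ b := by
            gcongr
            · rw [mul_comm]
              exact ENNReal.mul_div_le.trans (by gcongr; exact min_le_left _ _)
            · rw [mul_comm]
              exact ENNReal.mul_div_le.trans (by gcongr; exact min_le_left _ _)
        _ ≤ _ := hfg x y)
  have hI : ∀ (k : ℝ → ℝ≥0∞) (L : ℝ≥0∞), L ≠ 0 → L ≠ ∞ →
      ∫⁻ x, k x = (∫⁻ x, k x / L) * L := by
    intro k L h0 h1
    rw [← lintegral_mul_const' _ _ h1]
    simp only [ENNReal.div_mul_cancel h0 h1]
  calc (∫⁻ x, min (f x) c) ^ a * (∫⁻ x, min (g x) c) ^ b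
      = ((∫⁻ x, min (f x) c / M) ^ a * (∫⁻ x, min (g x) c / N) ^ b) * γ := by
        rw [hI (fun x => min (f x) c) M hM hM', hI (fun x => min (g x) c) N hN hN',
          ENNReal.mul_rpow_of_nonneg _ _ ha.le, ENNReal.mul_rpow_of_nonneg _ _ hb.le, hγ]
        ring
    _ ≤ (∫⁻ x, h x / γ) * γ := by
        gcongr
        refine (ENNReal.geom_mean_le_arith_mean2_weighted _ _ ha hb hab).trans
          (hcomb.trans (lintegral_mono fun x => min_le_left _ _))
    _ = ∫⁻ x, h x := (hI h γ hγ0 hγ').symm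

theorem prekopa_leindler {f g h : ℝ → ℝ≥0∞} (hf : ENNLogConcave f)
    (hg : ENNLogConcave g) (hh : ENNLogConcave h) {a b : ℝ} (ha : 0 < a) (hb : 0 < b)
    (hab : a + b = 1) (hfg : ∀ x y, f x ^ a * g y ^ b ≤ h (a * x + b * y)) :
    (∫⁻ x, f x) ^ a * (∫⁻ x, g x) ^ b ≤ ∫⁻ x, h x := by
  by_cases hf0 : ∫⁻ x, f x = 0
  · simp [hf0, ENNReal.zero_rpow_of_pos ha]
  by_cases hg0 : ∫⁻ x, g x = 0
  · simp [hg0, ENNReal.zero_rpow_of_pos hb]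
  have hlim : ∀ k : ℝ → ℝ≥0∞, ENNLogConcave k →
      Tendsto (fun n : ℕ => ∫⁻ x, min (k x) n) atTop (nhds (∫⁻ x, k x)) := by
    intro k hk
    refine lintegral_tendsto_of_tendsto_of_monotone
      (fun n => hk.aemeasurable.min aemeasurable_const) (ae_of_all _ fun x m n hmn => ?_)
      (ae_of_all _ fun x => ?_)
    · exact min_le_min_left _ (by exact_mod_cast hmn)
    · simpa using (tendsto_const_nhds (x := k x)).min ENNReal.tendsto_nat_nhds_top
  refine le_of_tendsto (ENNReal.Tendsto.mul ((hlim f hf).ennrpow_const a) (Or.inl ?_)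
    ((hlim g hg).ennrpow_const b) (Or.inl ?_))
    (Eventually.of_forall fun n =>
      prekopa_leindler_truncated hf hg hh ha hb hab hfg (ENNReal.natCast_ne_top n))
  · simp [ENNReal.rpow_eq_zero_iff, hf0, ha.le]
  · simp [ENNReal.rpow_eq_zero_iff, hg0, hb.le]

namespace ENNLogConcave

theorem lintegral_real {V : Type*} [AddCommGroup V] [Module ℝ V] {f : V × ℝ → ℝ≥0∞}
    (hf : ENNLogConcave f) : ENNLogConcave fun v => ∫⁻ s : ℝ, f (v, s) := by
  have hsec : ∀ v, ENNLogConcave fun s : ℝ => f (v, s) := fun v =>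
    hf.comp_affine (fun s => (v, s)) fun x y a b hab => by
      simp [← add_smul, hab]
  intro v w a b ha hb hab
  exact prekopa_leindler (hsec v) (hsec w) (hsec _) ha hb hab
    fun x y => hf (v, x) (w, y) a b ha hb hab

theorem lintegral_pi {d : ℕ} {V : Type} [AddCommGroup V] [Module ℝ V]
    {f : V × (Fin d → ℝ) → ℝ≥0∞} (hf : ENNLogConcave f) :
    ENNLogConcave fun v => ∫⁻ y : Fin d → ℝ, f (v, y) := by
  induction d generalizing V with
  | zero =>
    have h1 : (volume : Measure (Fin 0 → ℝ)) Set.univ = 1 := by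
      rw [Measure.volume_pi_eq_dirac, measure_univ]
    simp only [lintegral_unique, h1, mul_one]
    refine hf.comp_affine (fun v => (v, _)) fun x y a b hab => by
      simp only [Prod.smul_mk, Prod.mk_add_mk, Prod.mk.injEq, true_and]
      exact Subsingleton.elim _ _
  | succ d ih =>
    let e := MeasurableEquiv.piFinSuccAbove (fun _ : Fin (d + 1) => ℝ) 0
    have he : ∀ (s : ℝ) (y : Fin d → ℝ), e.symm (s, y) = Fin.cons s y := by
      intro s y
      simp [e, MeasurableEquiv.piFinSuccAbove, Fin.consEquiv]
    have hcons : ∀ (s t : ℝ) (y z : Fin d → ℝ) (a b : ℝ),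
        (Fin.cons (a * s + b * t) (a • y + b • z) : Fin (d + 1) → ℝ) =
          a • (Fin.cons s y : Fin (d + 1) → ℝ) + b • (Fin.cons t z : Fin (d + 1) → ℝ) := by
      intro s t y z a b
      ext i
      refine Fin.cases ?_ (fun j => ?_) i <;> simp
    have h1 : ENNLogConcave fun q : (V × ℝ) × (Fin d → ℝ) =>
        f (q.1.1, (Fin.cons q.1.2 q.2 : Fin (d + 1) → ℝ)) :=
      hf.comp_affine (fun q : (V × ℝ) × (Fin d → ℝ) =>
        (q.1.1, (Fin.cons q.1.2 q.2 : Fin (d + 1) → ℝ))) fun x y a b hab => by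
        simp [hcons]
    have h2 : ∀ v, ENNLogConcave fun q : ℝ × (Fin d → ℝ) =>
        f (v, (Fin.cons q.1 q.2 : Fin (d + 1) → ℝ)) := fun v =>
      h1.comp_affine (fun q : ℝ × (Fin d → ℝ) => ((v, q.1), q.2)) fun x y a b hab => by
        simp [← add_smul, hab]
    have h3 : ∀ v, ∫⁻ y : Fin (d + 1) → ℝ, f (v, y) =
        ∫⁻ s : ℝ, ∫⁻ y : Fin d → ℝ, f (v, (Fin.cons s y : Fin (d + 1) → ℝ)) := by
      intro v
      have hmp := (volume_preserving_piFinSuccAbove (fun _ : Fin (d + 1) => ℝ) 0).symm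
      rw [← hmp.lintegral_comp_emb (MeasurableEquiv.measurableEmbedding _)]
      change ∫⁻ q : ℝ × (Fin d → ℝ), f (v, e.symm (q.1, q.2)) = _
      simp only [he]
      rw [← lintegral_prod (fun q : ℝ × (Fin d → ℝ) =>
        f (v, (Fin.cons q.1 q.2 : Fin (d + 1) → ℝ)))]
      · rfl
      · exact (h2 v).aemeasurable (μ := (volume : Measure ℝ).prod (volume : Measure (Fin d → ℝ)))
    simp only [h3]
    exact (ih h1).lintegral_real

theorem lintegral_euclidean {d : ℕ} {V : Type} [AddCommGroup V] [Module ℝ V]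
    {f : V × EuclideanSpace ℝ (Fin d) → ℝ≥0∞} (hf : ENNLogConcave f) :
    ENNLogConcave fun v => ∫⁻ y : EuclideanSpace ℝ (Fin d), f (v, y) := by
  have h : ∀ v, ∫⁻ y : EuclideanSpace ℝ (Fin d), f (v, y) =
      ∫⁻ y : Fin d → ℝ, f (v, WithLp.toLp 2 y) := fun v =>
    ((PiLp.volume_preserving_toLp (Fin d)).lintegral_comp_emb
      (MeasurableEquiv.toLp 2 (Fin d → ℝ)).measurableEmbedding _).symm
  simp only [h]
  refine lintegral_pi (f := fun q : V × (Fin d → ℝ) => f (q.1, WithLp.toLp 2 q.2)) ?_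
  exact hf.comp_affine (fun q : V × (Fin d → ℝ) => (q.1, WithLp.toLp 2 q.2))
    fun x y a b hab => by simp

end ENNLogConcave

namespace LogConcaveTail

variable {F : ℝ → ℝ}

/-- Log-concavity of a real function on the line, in the form used for tail functions. -/
def RealLogConcave (F : ℝ → ℝ) : Prop :=
  ∀ s t a b : ℝ, 0 < a → 0 < b → a + b = 1 → F s ^ a * F t ^ b ≤ F (a * s + b * t)

theorem exp_lt_of_exp_lt (hF : RealLogConcave F) (h0 : 0 < F 0) {k s t : ℝ} (ht : 0 < t)
    (hts : t ≤ s) (hs : F 0 * Real.exp (-(k * s)) < F s) : F 0 * Real.exp (-(k * t)) < F t := by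
  rcases hts.eq_or_lt with rfl | hts
  · exact hs
  have hs0 : 0 < s := ht.trans hts
  have hu : 0 < t / s := div_pos ht hs0
  have hu1 : 0 < 1 - t / s := by rw [sub_pos, div_lt_one hs0]; exact hts
  have h := hF 0 s (1 - t / s) (t / s) hu1 hu (by ring)
  rw [mul_zero, zero_add, div_mul_cancel₀ _ hs0.ne'] at h
  refine lt_of_lt_of_le ?_ h
  calc F 0 * Real.exp (-(k * t))
      = F 0 ^ (1 - t / s) * (F 0 * Real.exp (-(k * s))) ^ (t / s) := by
        rw [Real.mul_rpow h0.le (Real.exp_pos _).le, ← mul_assoc, ← Real.rpow_add h0,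
          sub_add_cancel, Real.rpow_one, ← Real.exp_mul]
        congr 2
        field_simp
    _ < F 0 ^ (1 - t / s) * F s ^ (t / s) := by
        refine mul_lt_mul_of_pos_left ?_ (Real.rpow_pos_of_pos h0 _)
        exact Real.rpow_lt_rpow (by positivity) hs hu

theorem le_exp_of_le_exp (hF : RealLogConcave F) (h0 : 0 < F 0) {k s t : ℝ} (hs0 : 0 < s)
    (hst : s ≤ t) (hs : F s ≤ F 0 * Real.exp (-(k * s))) : F t ≤ F 0 * Real.exp (-(k * t)) :=
  not_lt.1 fun h => not_lt.2 hs (exp_lt_of_exp_lt hF h0 hs0 hst h)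

theorem le_exp_of_neg (hF : RealLogConcave F) (h0 : 0 < F 0) {k s t : ℝ} (hs0 : 0 < s)
    (ht : t < 0) (hs : F 0 * Real.exp (-(k * s)) < F s) : F t ≤ F 0 * Real.exp (-(k * t)) := by
  by_contra! hlt
  have hd : 0 < s - t := by linarith
  have h := hF t s (s / (s - t)) (-t / (s - t)) (div_pos hs0 hd) (div_pos (by linarith) hd)
    (by field_simp; ring)
  have e0 : s / (s - t) * t + -t / (s - t) * s = 0 := by field_simp; ring
  rw [e0] at h
  refine lt_irrefl (F 0) (lt_of_lt_of_le ?_ h)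
  calc F 0 = (F 0 * Real.exp (-(k * t))) ^ (s / (s - t)) *
        (F 0 * Real.exp (-(k * s))) ^ (-t / (s - t)) := by
        rw [Real.mul_rpow h0.le (Real.exp_pos _).le, Real.mul_rpow h0.le (Real.exp_pos _).le,
          ← Real.exp_mul, ← Real.exp_mul, mul_mul_mul_comm, ← Real.rpow_add h0, ← Real.exp_add]
        have e1 : s / (s - t) + -t / (s - t) = 1 := by field_simp; ring
        have e2 : -(k * t) * (s / (s - t)) + -(k * s) * (-t / (s - t)) = 0 := by
          field_simp
          ring
        rw [e1, e2, Real.rpow_one, Real.exp_zero, mul_one]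
    _ < F t ^ (s / (s - t)) * F s ^ (-t / (s - t)) := by
        refine mul_lt_mul'' ?_ ?_ (by positivity) (by positivity)
        · exact Real.rpow_lt_rpow (by positivity) hlt (div_pos hs0 hd)
        · exact Real.rpow_lt_rpow (by positivity) hs (div_pos (by linarith) hd)

theorem integrableOn_pow_mul_exp (n : ℕ) {k : ℝ} (hk : 0 < k) :
    IntegrableOn (fun t : ℝ => t ^ n * Real.exp (-(k * t))) (Set.Ioi 0) := by
  have h := integrableOn_rpow_mul_exp_neg_mul_rpow (p := 1) (s := n)
    (neg_one_lt_zero.trans_le n.cast_nonneg) one_pos hk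
  simpa using h

theorem integral_pow_mul_exp (n : ℕ) {k : ℝ} (hk : 0 < k) :
    ∫ t in Set.Ioi (0 : ℝ), t ^ n * Real.exp (-(k * t)) = n.factorial / k ^ (n + 1) := by
  have h := Real.integral_rpow_mul_exp_neg_mul_Ioi (a := n + 1) (r := k) (by positivity) hk
  rw [Real.Gamma_nat_eq_factorial, add_sub_cancel_right] at h
  simp only [Real.rpow_natCast] at h
  rw [h, one_div, ← Nat.cast_succ, Real.rpow_natCast, inv_pow, mul_comm, div_eq_mul_inv]

theorem exists_exp_bound (hF : RealLogConcave F) (hnn : ∀ t, 0 ≤ F t) (hanti : Antitone F)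
    (hlim : Tendsto F atTop (nhds 0)) :
    ∃ C c : ℝ, 0 < c ∧ ∀ t, 0 < t → F t ≤ C * Real.exp (-(c * t)) := by
  rcases (hnn 0).eq_or_lt with h0 | h0
  · exact ⟨0, 1, one_pos, fun t ht => by simpa [← h0] using hanti ht.le⟩
  obtain ⟨s, hs, hs0⟩ := ((hlim.eventually_le_const (half_pos h0)).and
    (eventually_gt_atTop 0)).exists
  have hc : 0 < Real.log 2 / s := div_pos (Real.log_pos one_lt_two) hs0
  have hes : Real.exp (-(Real.log 2 / s * s)) = 1 / 2 := by
    rw [div_mul_cancel₀ _ hs0.ne', Real.exp_neg, Real.exp_log two_pos, one_div]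
  refine ⟨2 * F 0, _, hc, fun t ht => ?_⟩
  rcases le_total s t with hst | hts
  · have := le_exp_of_le_exp hF h0 (k := Real.log 2 / s) hs0 hst (by rw [hes]; linarith)
    have h2 : 0 ≤ F 0 * Real.exp (-(Real.log 2 / s * t)) := by positivity
    linarith
  · have h1 : Real.exp (-(Real.log 2 / s * s)) ≤ Real.exp (-(Real.log 2 / s * t)) := by
      gcongr
    rw [hes] at h1
    have := hanti ht.le
    nlinarith

theorem integrableOn_pow_mul (hF : RealLogConcave F) (hnn : ∀ t, 0 ≤ F t) (hanti : Antitone F)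
    (hlim : Tendsto F atTop (nhds 0)) (n : ℕ) :
    IntegrableOn (fun t : ℝ => t ^ n * F t) (Set.Ioi 0) := by
  obtain ⟨C, c, hc, hb⟩ := exists_exp_bound hF hnn hanti hlim
  refine Integrable.mono' ((integrableOn_pow_mul_exp n hc).const_mul C) ?_ ?_
  · exact ((measurable_id.pow_const n).mul hanti.measurable).aestronglyMeasurable
  · refine (ae_restrict_iff' measurableSet_Ioi).2 (ae_of_all _ fun t ht => ?_)
    have ht' : (0 : ℝ) < t := ht
    have := hnn t
    rw [Real.norm_of_nonneg (by positivity)]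
    calc t ^ n * F t ≤ t ^ n * (C * Real.exp (-(c * t))) := by gcongr; exact hb t ht
      _ = C * (t ^ n * Real.exp (-(c * t))) := by ring

theorem third_moment_le_of_lt (hF : RealLogConcave F) (hnn : ∀ t, 0 ≤ F t) (hanti : Antitone F)
    (hlim : Tendsto F atTop (nhds 0)) {J : ℝ} (hJ : ∫ t in Set.Ioi (0 : ℝ), t ^ 1 * F t < J) :
    F 0 * ∫ t in Set.Ioi (0 : ℝ), t ^ 3 * F t ≤ 6 * J ^ 2 := by
  rcases (hnn 0).eq_or_lt with h0 | h0
  · rw [← h0, zero_mul]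
    positivity
  have hJ0 : 0 < J := lt_of_le_of_lt (setIntegral_nonneg measurableSet_Ioi fun t ht =>
    mul_nonneg (pow_nonneg (le_of_lt ht) _) (hnn t)) hJ
  set k := Real.sqrt (F 0 / J) with hkdef
  have hk : 0 < k := Real.sqrt_pos.2 (div_pos h0 hJ0)
  have hk2 : k ^ 2 = F 0 / J := Real.sq_sqrt (div_pos h0 hJ0).le
  have hI := integrableOn_pow_mul hF hnn hanti hlim
  have hE := fun n => (integrableOn_pow_mul_exp n hk).const_mul (F 0)
  have hE1 : ∫ t in Set.Ioi (0 : ℝ), F 0 * (t ^ 1 * Real.exp (-(k * t))) = J := by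
    rw [integral_const_mul, integral_pow_mul_exp 1 hk, hk2]
    simp
    field_simp
  have hE3 : ∫ t in Set.Ioi (0 : ℝ), F 0 * (t ^ 3 * Real.exp (-(k * t))) = 6 * J ^ 2 / F 0 := by
    have hk4 : k ^ (3 + 1) = (F 0 / J) ^ 2 := by rw [← hk2]; ring
    rw [integral_const_mul, integral_pow_mul_exp 3 hk, hk4]
    simp [Nat.factorial]
    field_simp
  have hex : ∃ s, 0 < s ∧ F s ≤ F 0 * Real.exp (-(k * s)) := by
    by_contra! hcon
    refine not_lt.2 ?_ hJ
    rw [← hE1]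
    refine setIntegral_mono_on (hE 1) (hI 1) measurableSet_Ioi fun t ht => ?_
    have h1 := (hcon t ht).le
    have ht' : (0 : ℝ) < t := ht
    calc F 0 * (t ^ 1 * Real.exp (-(k * t))) = t ^ 1 * (F 0 * Real.exp (-(k * t))) := by ring
      _ ≤ t ^ 1 * F t := by gcongr
  let S := {s : ℝ | 0 < s ∧ F s ≤ F 0 * Real.exp (-(k * s))}
  have hSb : BddBelow S := ⟨0, fun s hs => hs.1.le⟩
  set τ := sInf S with hτ
  have hτ0 : 0 ≤ τ := le_csInf hex fun s hs => hs.1.le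
  have hpt : ∀ t ∈ Set.Ioi (0 : ℝ), t ^ 3 * F t - F 0 * (t ^ 3 * Real.exp (-(k * t))) ≤
      τ ^ 2 * (t ^ 1 * F t - F 0 * (t ^ 1 * Real.exp (-(k * t)))) := by
    intro t ht
    have ht' : (0 : ℝ) < t := ht
    have : t * ((t ^ 2 - τ ^ 2) * (F t - F 0 * Real.exp (-(k * t)))) ≤ 0 := by
      refine mul_nonpos_of_nonneg_of_nonpos ht'.le ?_
      rcases lt_trichotomy t τ with h | h | h
      · have h1 : ¬ F t ≤ F 0 * Real.exp (-(k * t)) := fun hle =>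
          not_lt.2 (csInf_le hSb ⟨ht', hle⟩) h
        exact mul_nonpos_of_nonpos_of_nonneg (by nlinarith) (by linarith)
      · simp [h]
      · obtain ⟨s, hs, hst⟩ := exists_lt_of_csInf_lt hex h
        have := le_exp_of_le_exp hF h0 hs.1 hst.le hs.2
        exact mul_nonpos_of_nonneg_of_nonpos (by nlinarith) (by linarith)
    nlinarith
  have hint := setIntegral_mono_on ((hI 3).sub (hE 3)) (((hI 1).sub (hE 1)).const_mul (τ ^ 2))
    measurableSet_Ioi hpt
  rw [integral_const_mul] at hint
  simp only [Pi.sub_apply] at hint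
  rw [integral_sub (hI 3) (hE 3), integral_sub (hI 1) (hE 1), hE1, hE3] at hint
  have h4 : ∫ t in Set.Ioi (0 : ℝ), t ^ 3 * F t ≤ 6 * J ^ 2 / F 0 := by
    have := mul_nonneg (sq_nonneg τ) (sub_nonneg.2 hJ.le)
    linarith
  calc _ ≤ F 0 * (6 * J ^ 2 / F 0) := by gcongr
    _ = 6 * J ^ 2 := by field_simp

theorem third_moment_le (hF : RealLogConcave F) (hnn : ∀ t, 0 ≤ F t) (hanti : Antitone F)
    (hlim : Tendsto F atTop (nhds 0)) :
    F 0 * ∫ t in Set.Ioi (0 : ℝ), t ^ 3 * F t ≤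
      6 * (∫ t in Set.Ioi (0 : ℝ), t ^ 1 * F t) ^ 2 := by
  set m := ∫ t in Set.Ioi (0 : ℝ), t ^ 1 * F t
  have hc : Tendsto (fun J : ℝ => 6 * J ^ 2) (nhdsWithin m (Set.Ioi m)) (nhds (6 * m ^ 2)) :=
    Continuous.tendsto' (by fun_prop) _ _ rfl |>.mono_left nhdsWithin_le_nhds
  exact ge_of_tendsto hc (eventually_mem_nhdsWithin.mono fun J hJ =>
    third_moment_le_of_lt hF hnn hanti hlim hJ)

theorem le_exp_two_of_integral (hF : RealLogConcave F) (hnn : ∀ t, 0 ≤ F t) (hanti : Antitone F)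
    (hlim : Tendsto F atTop (nhds 0)) (h0 : 0 < F 0) {m : ℝ} (hm : 0 < m)
    (hint : ∫ t in Set.Ioi (0 : ℝ), t ^ 0 * F t = m) :
    F (-(m / F 0)) ≤ F 0 * Real.exp 2 := by
  set k := 2 * F 0 / m with hkdef
  have hk : 0 < k := by positivity
  have hex : ∃ s, 0 < s ∧ F 0 * Real.exp (-(k * s)) < F s := by
    by_contra! hcon
    have h1 : ∫ t in Set.Ioi (0 : ℝ), t ^ 0 * F t ≤
        ∫ t in Set.Ioi (0 : ℝ), F 0 * (t ^ 0 * Real.exp (-(k * t))) := by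
      refine setIntegral_mono_on (integrableOn_pow_mul hF hnn hanti hlim 0)
        ((integrableOn_pow_mul_exp 0 hk).const_mul _) measurableSet_Ioi fun t ht => ?_
      simpa using hcon t ht
    rw [integral_const_mul, integral_pow_mul_exp 0 hk, hint] at h1
    have h2 : F 0 * ((Nat.factorial 0 : ℝ) / k ^ (0 + 1)) = m / 2 := by
      rw [hkdef]
      simp
      field_simp
    linarith
  obtain ⟨s, hs, hlt⟩ := hex
  have h := le_exp_of_neg hF h0 hs (t := -(m / F 0)) (by simpa using div_pos hm h0) hlt
  refine h.trans_eq ?_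
  congr 2
  rw [hkdef]
  field_simp

end LogConcaveTail

namespace LogConcaveTail

variable {Ω : Type*} [MeasurableSpace Ω] {P : Measure Ω} [IsProbabilityMeasure P] {Y : Ω → ℝ}

theorem realLogConcave_tail (hT : ENNLogConcave fun t : ℝ => P {ω | t < Y ω}) :
    RealLogConcave fun t => P.real {ω | t < Y ω} := by
  intro s t a b ha hb hab
  simp only [measureReal_def, ENNReal.toReal_rpow, ← ENNReal.toReal_mul]
  exact ENNReal.toReal_mono (measure_ne_top _ _) (hT s t a b ha hb hab)

theorem antitone_tail : Antitone fun t => P.real {ω | t < Y ω} :=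
  fun _ _ hst => measureReal_mono fun _ hω => lt_of_le_of_lt hst hω

theorem tendsto_tail (hY : Measurable Y) :
    Tendsto (fun t => P.real {ω | t < Y ω}) atTop (nhds 0) := by
  have h := tendsto_measure_iInter_atTop (μ := P) (s := fun t : ℝ => {ω | t < Y ω})
    (fun t => (measurableSet_lt measurable_const hY).nullMeasurableSet)
    (fun s t hst ω hω => lt_of_le_of_lt hst hω) ⟨0, measure_ne_top _ _⟩
  have he : ⋂ t : ℝ, {ω | t < Y ω} = ∅ :=
    Set.eq_empty_of_forall_notMem fun ω hω => lt_irrefl (Y ω) (Set.mem_iInter.1 hω (Y ω))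
  rw [he, measure_empty] at h
  exact (ENNReal.tendsto_toReal ENNReal.zero_ne_top).comp h

theorem lintegral_posPart_pow (hY : Measurable Y)
    (hT : ENNLogConcave fun t : ℝ => P {ω | t < Y ω}) (n : ℕ) :
    ∫⁻ ω, ENNReal.ofReal (max (Y ω) 0 ^ (n + 1)) ∂P =
      ENNReal.ofReal ((n + 1) * ∫ t in Set.Ioi (0 : ℝ), t ^ n * P.real {ω | t < Y ω}) := by
  have h := lintegral_rpow_eq_lintegral_meas_lt_mul P (f := fun ω => max (Y ω) 0)
    (ae_of_all _ fun ω => le_max_right _ _) (hY.max measurable_const).aemeasurable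
    (p := ((n + 1 : ℕ) : ℝ)) (by positivity)
  have hnn : ∀ t : ℝ, 0 ≤ P.real {ω | t < Y ω} := fun t => measureReal_nonneg
  simp only [Real.rpow_natCast] at h
  rw [h, Nat.cast_succ, ENNReal.ofReal_mul (by positivity), ofReal_integral_eq_lintegral_ofReal
    (integrableOn_pow_mul (realLogConcave_tail hT) hnn antitone_tail (tendsto_tail hY) n)]
  · congr 1
    refine setLIntegral_congr_fun measurableSet_Ioi fun t ht => ?_
    have ht' : (0 : ℝ) < t := ht
    have he : {ω | t < max (Y ω) 0} = {ω | t < Y ω} := by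
      ext ω
      simp [not_lt.2 ht'.le]
    simp only [he, add_sub_cancel_right, Real.rpow_natCast]
    rw [ENNReal.ofReal_mul (by positivity), ofReal_measureReal, mul_comm]
  · exact (ae_restrict_iff' measurableSet_Ioi).2 (ae_of_all _ fun t ht =>
      mul_nonneg (pow_nonneg (le_of_lt ht) _) (hnn t))

theorem integrable_posPart_pow (hY : Measurable Y)
    (hT : ENNLogConcave fun t : ℝ => P {ω | t < Y ω}) (n : ℕ) :
    Integrable (fun ω => max (Y ω) 0 ^ (n + 1)) P := by
  refine ⟨((hY.max measurable_const).pow_const _).aestronglyMeasurable, ?_⟩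
  rw [hasFiniteIntegral_iff_ofReal (ae_of_all _ fun ω => by positivity),
    lintegral_posPart_pow hY hT n]
  exact ENNReal.ofReal_lt_top

theorem integral_posPart_pow (hY : Measurable Y)
    (hT : ENNLogConcave fun t : ℝ => P {ω | t < Y ω}) (n : ℕ) :
    ∫ ω, max (Y ω) 0 ^ (n + 1) ∂P =
      (n + 1) * ∫ t in Set.Ioi (0 : ℝ), t ^ n * P.real {ω | t < Y ω} := by
  have h0 : 0 ≤ ∫ t in Set.Ioi (0 : ℝ), t ^ n * P.real {ω | t < Y ω} :=
    setIntegral_nonneg measurableSet_Ioi fun t ht =>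
      mul_nonneg (pow_nonneg (le_of_lt ht) _) measureReal_nonneg
  rw [integral_eq_lintegral_of_nonneg_ae (ae_of_all _ fun ω => by positivity)
    ((hY.max measurable_const).pow_const _).aestronglyMeasurable,
    lintegral_posPart_pow hY hT n, ENNReal.toReal_ofReal (by positivity)]

/-- A weak form of Grünbaum's inequality. -/
theorem one_tenth_le_tail_zero (hY : Measurable Y)
    (hT : ENNLogConcave fun t : ℝ => P {ω | t < Y ω}) (hYi : Integrable Y P)
    (hmean : ∫ ω, Y ω ∂P = 0) (h0 : 0 < P.real {ω | 0 < Y ω}) :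
    1 / 10 ≤ P.real {ω | 0 < Y ω} := by
  set a := P.real {ω | 0 < Y ω} with ha
  have hp : Integrable (fun ω => max (Y ω) 0) P := by
    simpa using integrable_posPart_pow hY hT 0
  have hq : Integrable (fun ω => max (-Y ω) 0) P := by
    have := hp.sub hYi
    refine this.congr (ae_of_all _ fun ω => ?_)
    rcases le_total (Y ω) 0 with h | h <;> simp [h]
  set m := ∫ ω, max (Y ω) 0 ∂P with hm
  have hqm : ∫ ω, max (-Y ω) 0 ∂P = m := by
    have h1 : ∫ ω, (max (Y ω) 0 - max (-Y ω) 0) ∂P = ∫ ω, Y ω ∂P := by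
      refine integral_congr_ae (ae_of_all _ fun ω => ?_)
      rcases le_total (Y ω) 0 with h | h <;> simp [h]
    rw [integral_sub hp hq, hmean] at h1
    linarith
  have hm0 : 0 < m := by
    refine (integral_pos_iff_support_of_nonneg (fun ω => le_max_right _ _) hp).2 ?_
    refine (ENNReal.toReal_pos_iff.1 h0).1.trans_le (measure_mono fun ω hω => ?_)
    exact (lt_max_of_lt_left hω : (0 : ℝ) < max (Y ω) 0).ne'
  have hint : ∫ t in Set.Ioi (0 : ℝ), t ^ 0 * P.real {ω | t < Y ω} = m := by
    have := integral_posPart_pow hY hT 0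
    simp only [zero_add, pow_one, Nat.cast_zero, one_mul] at this
    rw [← this]
  have h1 := le_exp_two_of_integral (realLogConcave_tail hT) (fun t => measureReal_nonneg)
    antitone_tail (tendsto_tail hY) h0 hm0 hint
  have h2 := mul_meas_ge_le_integral_of_nonneg (ae_of_all P fun ω => le_max_right (-Y ω) 0)
    hq (m / a)
  have hma : 0 < m / a := div_pos hm0 h0
  have hset : {ω | m / a ≤ max (-Y ω) 0} = {ω | -(m / a) < Y ω}ᶜ := by
    ext ω
    simp only [Set.mem_ofPred_eq, le_max_iff, not_le.2 hma, or_false, Set.mem_compl_iff, not_lt]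
    exact le_neg
  rw [hqm, hset, probReal_compl_eq_one_sub (measurableSet_lt measurable_const hY)] at h2
  have h3 : 1 - P.real {ω | -(m / a) < Y ω} ≤ a := by
    have h4 : m / a * (1 - P.real {ω | -(m / a) < Y ω}) ≤ m / a * a := by
      rwa [div_mul_cancel₀ _ h0.ne']
    exact le_of_mul_le_mul_left h4 hma
  have h5 : Real.exp 2 < 9 := by
    have h6 := Real.exp_one_lt_three
    have h7 : Real.exp 2 = Real.exp 1 * Real.exp 1 := by
      rw [← Real.exp_add]
      norm_num
    nlinarith [Real.exp_pos 1]
  simp only [← ha] at h1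
  nlinarith

theorem fourth_moment_posPart_le (hY : Measurable Y)
    (hT : ENNLogConcave fun t : ℝ => P {ω | t < Y ω}) (hYi : Integrable Y P)
    (hmean : ∫ ω, Y ω ∂P = 0) :
    ∫ ω, max (Y ω) 0 ^ 4 ∂P ≤ 60 * (∫ ω, max (Y ω) 0 ^ 2 ∂P) ^ 2 := by
  have h4 := integral_posPart_pow hY hT 3
  have h2 := integral_posPart_pow hY hT 1
  have hthird := third_moment_le (realLogConcave_tail hT) (fun t => measureReal_nonneg)
    antitone_tail (tendsto_tail hY)
  have hnn : 0 ≤ ∫ t in Set.Ioi (0 : ℝ), t ^ 3 * P.real {ω | t < Y ω} :=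
    setIntegral_nonneg measurableSet_Ioi fun t ht =>
      mul_nonneg (pow_nonneg (le_of_lt ht) _) measureReal_nonneg
  norm_num at h4 h2
  rcases (measureReal_nonneg (μ := P) (s := {ω | 0 < Y ω})).eq_or_lt with h0 | h0
  · have hz : ∀ t ∈ Set.Ioi (0 : ℝ), t ^ 3 * P.real {ω | t < Y ω} = 0 := fun t ht => by
      have h1 : P.real {ω | t < Y ω} ≤ P.real {ω | 0 < Y ω} := antitone_tail (le_of_lt ht)
      rw [← h0] at h1
      rw [le_antisymm h1 measureReal_nonneg, mul_zero]
    rw [h4, setIntegral_eq_zero_of_forall_eq_zero hz, mul_zero]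
    positivity
  · have h1 := one_tenth_le_tail_zero hY hT hYi hmean h0
    rw [h4, h2]
    simp only [pow_one] at hthird
    nlinarith

theorem integrable_pow_four (hY : Measurable Y)
    (hT : ENNLogConcave fun t : ℝ => P {ω | t < Y ω})
    (hT' : ENNLogConcave fun t : ℝ => P {ω | t < -Y ω}) : Integrable (fun ω => Y ω ^ 4) P := by
  refine ((integrable_posPart_pow hY hT 3).add (integrable_posPart_pow (Y := fun ω => -Y ω) hY.neg hT' 3)).congr
    (ae_of_all _ fun ω => ?_)
  rcases le_total (Y ω) 0 with h | h <;> simp [h, Even.neg_pow (by decide : Even 4)]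

theorem memLp_four (hY : Measurable Y)
    (hT : ENNLogConcave fun t : ℝ => P {ω | t < Y ω})
    (hT' : ENNLogConcave fun t : ℝ => P {ω | t < -Y ω}) : MemLp Y 4 P := by
  rw [← integrable_norm_rpow_iff hY.aestronglyMeasurable (by norm_num) (by norm_num)]
  refine (integrable_pow_four hY hT hT').congr (ae_of_all _ fun ω => ?_)
  have h4 : ENNReal.toReal 4 = ((4 : ℕ) : ℝ) := by norm_num
  simp only [h4, Real.rpow_natCast, Real.norm_eq_abs, Even.pow_abs (by decide : Even 4)]

/-- A centred random variable both of whose tails are log-concave satisfies a reverse Hölder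
inequality between its fourth and second moments. -/
theorem fourth_moment_le (hY : Measurable Y)
    (hT : ENNLogConcave fun t : ℝ => P {ω | t < Y ω})
    (hT' : ENNLogConcave fun t : ℝ => P {ω | t < -Y ω}) (hmean : ∫ ω, Y ω ∂P = 0) :
    ∫ ω, Y ω ^ 4 ∂P ≤ 60 * (∫ ω, Y ω ^ 2 ∂P) ^ 2 := by
  have hYi : Integrable Y P := (memLp_four hY hT hT').integrable (by norm_num)
  have h1 := fourth_moment_posPart_le hY hT hYi hmean
  have hYn : Measurable fun ω => -Y ω := hY.neg
  have h2 := fourth_moment_posPart_le hYn hT' hYi.neg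
    (by simpa [integral_neg] using hmean)
  have hsum : ∀ n : ℕ, n ≠ 0 → ∀ ω, Y ω ^ (2 * n) =
      max (Y ω) 0 ^ (2 * n) + max (-Y ω) 0 ^ (2 * n) := by
    intro n hn ω
    rcases le_total (Y ω) 0 with h | h <;> simp [h, hn]
  have e4 : ∫ ω, Y ω ^ 4 ∂P = ∫ ω, max (Y ω) 0 ^ 4 ∂P + ∫ ω, max (-Y ω) 0 ^ 4 ∂P := by
    rw [← integral_add (integrable_posPart_pow hY hT 3) (integrable_posPart_pow hYn hT' 3)]
    exact integral_congr_ae (ae_of_all _ (hsum 2 two_ne_zero))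
  have e2 : ∫ ω, Y ω ^ 2 ∂P = ∫ ω, max (Y ω) 0 ^ 2 ∂P + ∫ ω, max (-Y ω) 0 ^ 2 ∂P := by
    rw [← integral_add (integrable_posPart_pow hY hT 1) (integrable_posPart_pow hYn hT' 1)]
    exact integral_congr_ae (ae_of_all _ (hsum 1 one_ne_zero))
  have n1 : 0 ≤ ∫ ω, max (Y ω) 0 ^ 2 ∂P := integral_nonneg fun ω => by positivity
  have n2 : 0 ≤ ∫ ω, max (-Y ω) 0 ^ 2 ∂P := integral_nonneg fun ω => by positivity
  rw [e4, e2]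
  nlinarith [mul_nonneg n1 n2]

end LogConcaveTail

section MatrixSquareRoot

variable {d : ℕ} {M N : Matrix (Fin d) (Fin d) ℝ}

theorem transpose_matRpow (M : Matrix (Fin d) (Fin d) ℝ) (r : ℝ) :
    (matRpow M r)ᵀ = matRpow M r := by
  unfold matRpow
  split_ifs with hM
  · rw [← conjTranspose_eq_transpose_of_trivial]
    simp [star_eq_conjTranspose, mul_assoc]
  · exact transpose_zero

theorem matRpow_half_mul_self (hM : M.PosSemidef) :
    matRpow M ((1 : ℝ) / 2) * matRpow M ((1 : ℝ) / 2) = M := by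
  have hU : star (hM.1.eigenvectorUnitary : Matrix (Fin d) (Fin d) ℝ) *
      (hM.1.eigenvectorUnitary : Matrix (Fin d) (Fin d) ℝ) = 1 :=
    Unitary.coe_star_mul_self _
  have hD : diagonal (fun i => hM.1.eigenvalues i ^ ((1 : ℝ) / 2)) *
      diagonal (fun i => hM.1.eigenvalues i ^ ((1 : ℝ) / 2)) =
      diagonal hM.1.eigenvalues := by
    rw [diagonal_mul_diagonal]
    congr 1
    ext i
    rw [← Real.sqrt_eq_rpow, Real.mul_self_sqrt (hM.eigenvalues_nonneg i)]
  unfold matRpow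
  rw [dif_pos hM.1]
  conv_rhs => rw [hM.1.spectral_theorem, Unitary.conjStarAlgAut_apply]
  simp only [mul_assoc]
  rw [← mul_assoc (star _) (hM.1.eigenvectorUnitary : Matrix (Fin d) (Fin d) ℝ), hU, one_mul,
    ← mul_assoc (diagonal _) (diagonal _), hD]
  rfl

open scoped Matrix.Norms.L2Operator in
/-- The quadratic form of `N^{1/2} M N^{1/2}` is bounded by the spectral norm of
`M^{1/2} N M^{1/2}`. -/
theorem dotProduct_sqrt_conj_mulVec_le (hM : M.PosSemidef) (hN : N.PosSemidef) (w : Fin d → ℝ) :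
    (matRpow N ((1 : ℝ) / 2) *ᵥ w) ⬝ᵥ M *ᵥ (matRpow N ((1 : ℝ) / 2) *ᵥ w) ≤
      specNorm (matRpow M ((1 : ℝ) / 2) * N * matRpow M ((1 : ℝ) / 2)) * (w ⬝ᵥ w) := by
  set S := matRpow M ((1 : ℝ) / 2) with hS
  set R := matRpow N ((1 : ℝ) / 2) with hR
  have hSt : Sᵀ = S := transpose_matRpow M _
  have hRt : Rᵀ = R := transpose_matRpow N _
  have hSS : S * S = M := matRpow_half_mul_self hM
  have hRR : R * R = N := matRpow_half_mul_self hN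
  have hct : (R * S)ᴴ = S * R := by
    rw [conjTranspose_eq_transpose_of_trivial, transpose_mul, hSt, hRt]
  have hnorm : specNorm (S * N * S) = ‖S * R‖ ^ 2 := by
    have h := l2_opNorm_conjTranspose_mul_self (R * S)
    rw [← l2_opNorm_conjTranspose (R * S), hct] at h
    rw [pow_two, ← h, ← hRR]
    simp only [mul_assoc]
    rfl
  have hw : w ⬝ᵥ w = ‖WithLp.toLp 2 w‖ ^ 2 := by
    rw [EuclideanSpace.real_norm_sq_eq]
    simp [dotProduct, pow_two]
  have hq : (R *ᵥ w) ⬝ᵥ M *ᵥ (R *ᵥ w) = ‖WithLp.toLp 2 ((S * R) *ᵥ w)‖ ^ 2 := by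
    rw [EuclideanSpace.real_norm_sq_eq, ← hSS, ← mulVec_mulVec, dotProduct_mulVec,
      ← mulVec_transpose, hSt, mulVec_mulVec]
    simp [dotProduct, pow_two]
  rw [hq, hnorm, hw, ← mul_pow]
  gcongr
  exact l2_opNorm_mulVec (S * R) (WithLp.toLp 2 w)

theorem trace_sqrt_conj (hM : M.PosSemidef) (hN : N.PosSemidef) :
    trace (matRpow M ((1 : ℝ) / 2) * N * matRpow M ((1 : ℝ) / 2)) =
      trace (matRpow N ((1 : ℝ) / 2) * M * matRpow N ((1 : ℝ) / 2)) := by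
  rw [trace_mul_comm, ← mul_assoc, matRpow_half_mul_self hM, trace_mul_comm _ (matRpow N _),
    ← mul_assoc, matRpow_half_mul_self hN, trace_mul_comm]

end MatrixSquareRoot

section Moments

variable {Ω : Type*} [MeasurableSpace Ω] {P : Measure Ω}

theorem sq_integral_mul_le {f g : Ω → ℝ} (hf : MemLp f 2 P) (hg : MemLp g 2 P) :
    (∫ ω, f ω * g ω ∂P) ^ 2 ≤ (∫ ω, f ω ^ 2 ∂P) * ∫ ω, g ω ^ 2 ∂P := by
  have hfg : Integrable (fun ω => f ω * g ω) P := hf.integrable_mul hg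
  have key : ∀ t : ℝ, 0 ≤ (∫ ω, g ω ^ 2 ∂P) * (t * t) + (2 * ∫ ω, f ω * g ω ∂P) * t +
      ∫ ω, f ω ^ 2 ∂P := by
    intro t
    have h : 0 ≤ ∫ ω, (g ω ^ 2 * (t * t) + f ω * g ω * (2 * t)) + f ω ^ 2 ∂P :=
      integral_nonneg fun ω => by
        have : (g ω ^ 2 * (t * t) + f ω * g ω * (2 * t)) + f ω ^ 2 = (g ω * t + f ω) ^ 2 := by ring
        simp only [this]
        positivity
    have h1 : Integrable (fun ω => g ω ^ 2 * (t * t) + f ω * g ω * (2 * t)) P :=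
      (hg.integrable_sq.mul_const _).add (hfg.mul_const _)
    rw [integral_add h1 hf.integrable_sq,
      integral_add (hg.integrable_sq.mul_const _) (hfg.mul_const _), integral_mul_const,
      integral_mul_const] at h
    linarith
  have := discrim_le_zero key
  unfold discrim at this
  linarith

theorem memLp_sq_of_four {f : Ω → ℝ} (hf : MemLp f 4 P) : MemLp (fun ω => f ω ^ 2) 2 P := by
  have : ENNReal.HolderTriple 4 4 2 := ⟨by
    rw [← two_mul, show (4 : ℝ≥0∞) = 2 * 2 by norm_num,
      ENNReal.mul_inv (by simp) (by simp), ← mul_assoc,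
      ENNReal.mul_inv_cancel (by simp) (by simp), one_mul]⟩
  have h : MemLp (f * f) 2 P := hf.mul hf
  exact h.congr_norm (hf.1.pow 2) (ae_of_all _ fun ω => by simp [pow_two])

variable {ι : Type*} [Fintype ι] {K : ℝ}

/-- Hypercontractive random variables: the second moment of a sum of squares is controlled by the
sum of the second moments. -/
theorem integral_sum_sq_sq_le (hK : 0 ≤ K) {z : ι → Ω → ℝ} (hz : ∀ i, MemLp (z i) 4 P)
    (h4 : ∀ i, ∫ ω, z i ω ^ 4 ∂P ≤ (K * ∫ ω, z i ω ^ 2 ∂P) ^ 2) :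
    ∫ ω, (∑ i, z i ω ^ 2) ^ 2 ∂P ≤ (K * ∑ i, ∫ ω, z i ω ^ 2 ∂P) ^ 2 := by
  have hint : ∀ i j, Integrable (fun ω => z i ω ^ 2 * z j ω ^ 2) P := fun i j =>
    (memLp_sq_of_four (hz i)).integrable_mul (memLp_sq_of_four (hz j))
  have hE : ∀ i, 0 ≤ ∫ ω, z i ω ^ 2 ∂P := fun i => integral_nonneg fun ω => sq_nonneg _
  have hij : ∀ i j, ∫ ω, z i ω ^ 2 * z j ω ^ 2 ∂P ≤
      (K * ∫ ω, z i ω ^ 2 ∂P) * (K * ∫ ω, z j ω ^ 2 ∂P) := by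
    intro i j
    have h := sq_integral_mul_le (memLp_sq_of_four (hz i)) (memLp_sq_of_four (hz j))
    simp only [← pow_mul] at h
    refine abs_le_of_sq_le_sq' (h.trans ?_) (mul_nonneg (mul_nonneg hK (hE i))
      (mul_nonneg hK (hE j))) |>.2
    rw [mul_pow]
    exact mul_le_mul (h4 i) (h4 j) (integral_nonneg fun ω => (even_two_mul 2).pow_nonneg _) (sq_nonneg _)
  have h1 : ∀ ω, (∑ i, z i ω ^ 2) ^ 2 = ∑ i, ∑ j, z i ω ^ 2 * z j ω ^ 2 := fun ω => by
    rw [pow_two, Finset.sum_mul_sum]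
  simp only [h1]
  rw [Finset.mul_sum, pow_two, Finset.sum_mul_sum]
  rw [integral_finsetSum _ fun i _ => integrable_finsetSum _ fun j _ => hint i j]
  refine Finset.sum_le_sum fun i _ => ?_
  rw [integral_finsetSum _ fun j _ => hint i j]
  exact Finset.sum_le_sum fun j _ => hij i j

variable {d : ℕ} [IsFiniteMeasure P] {Y : Ω → Fin d → ℝ} {A B C : Matrix (Fin d) (Fin d) ℝ}

theorem integral_dotProduct_sq (hL : ∀ u : Fin d → ℝ, MemLp (fun ω => u ⬝ᵥ Y ω) 4 P)
    (hA : ∀ i j, A i j = ∫ ω, Y ω i * Y ω j ∂P) (u : Fin d → ℝ) :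
    ∫ ω, (u ⬝ᵥ Y ω) ^ 2 ∂P = u ⬝ᵥ A *ᵥ u := by
  have hY : ∀ i, MemLp (fun ω => Y ω i) 2 P := fun i => by
    simpa using (hL (Pi.single i 1)).mono_exponent (p := 2) (by norm_num)
  have hint : ∀ i j, Integrable (fun ω => u i * Y ω i * (u j * Y ω j)) P := fun i j =>
    ((hY i).const_mul (u i)).integrable_mul ((hY j).const_mul (u j))
  have h1 : ∀ ω, (u ⬝ᵥ Y ω) ^ 2 = ∑ i, ∑ j, u i * Y ω i * (u j * Y ω j) := fun ω => by
    rw [pow_two, dotProduct, Finset.sum_mul_sum]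
  simp only [h1]
  simp only [dotProduct, mulVec, Finset.mul_sum]
  rw [integral_finsetSum _ fun i _ => integrable_finsetSum _ fun j _ => hint i j]
  refine Finset.sum_congr rfl fun i _ => ?_
  rw [integral_finsetSum _ fun j _ => hint i j]
  refine Finset.sum_congr rfl fun j _ => ?_
  rw [hA, ← integral_mul_const, ← integral_const_mul]
  exact integral_congr_ae (ae_of_all _ fun ω => by ring)

theorem posSemidef_of_second_moments (hL : ∀ u : Fin d → ℝ, MemLp (fun ω => u ⬝ᵥ Y ω) 4 P)
    (hA : ∀ i j, A i j = ∫ ω, Y ω i * Y ω j ∂P) : A.PosSemidef := by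
  refine .of_dotProduct_mulVec_nonneg ?_ fun u => ?_
  · ext i j
    simp [hA, mul_comm]
  · rw [star_trivial, ← integral_dotProduct_sq hL hA]
    exact integral_nonneg fun ω => sq_nonneg _

/-- The bound on the tensor contraction, for any random vector whose one-dimensional marginals
are hypercontractive. -/
theorem sqrt_sum_integral_quadratic_mul_le (hK : 0 ≤ K)
    (hL : ∀ u : Fin d → ℝ, MemLp (fun ω => u ⬝ᵥ Y ω) 4 P)
    (h4 : ∀ u : Fin d → ℝ, ∫ ω, (u ⬝ᵥ Y ω) ^ 4 ∂P ≤ (K * ∫ ω, (u ⬝ᵥ Y ω) ^ 2 ∂P) ^ 2)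
    (hA : ∀ i j, A i j = ∫ ω, Y ω i * Y ω j ∂P) (hB : B.PosSemidef) (hC : C.PosSemidef) :
    Real.sqrt (∑ i, (∫ ω, (Y ω ⬝ᵥ C *ᵥ Y ω) * (matRpow B ((1 : ℝ) / 2) *ᵥ Y ω) i ∂P) ^ 2) ≤
      K * Real.sqrt (specNorm (matRpow A ((1 : ℝ) / 2) * B * matRpow A ((1 : ℝ) / 2))) *
        trace (matRpow A ((1 : ℝ) / 2) * C * matRpow A ((1 : ℝ) / 2)) := by
  have hApos : A.PosSemidef := posSemidef_of_second_moments hL hA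
  rw [trace_sqrt_conj hApos hC]
  set R := matRpow B ((1 : ℝ) / 2) with hR
  set Q := matRpow C ((1 : ℝ) / 2) with hQ
  set s := specNorm (matRpow A ((1 : ℝ) / 2) * B * matRpow A ((1 : ℝ) / 2)) with hs
  have hs0 : 0 ≤ s := norm_nonneg _
  have hRt : Rᵀ = R := transpose_matRpow B _
  have hQt : Qᵀ = Q := transpose_matRpow C _
  have hquad : ∀ y : Fin d → ℝ, y ⬝ᵥ C *ᵥ y = ∑ i, (Q i ⬝ᵥ y) ^ 2 := fun y => by
    rw [← matRpow_half_mul_self hC, ← mulVec_mulVec, dotProduct_mulVec, ← mulVec_transpose, hQt]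
    simp only [dotProduct, mulVec, pow_two, hQ]
  have htrace : ∑ i, ∫ ω, (Q i ⬝ᵥ Y ω) ^ 2 ∂P = trace (Q * A * Q) := by
    refine Finset.sum_congr rfl fun i _ => ?_
    rw [integral_dotProduct_sq hL hA, diag_apply, mul_assoc, mul_apply]
    refine Finset.sum_congr rfl fun j _ => ?_
    rw [mul_apply, mulVec, dotProduct]
    congr 1
    refine Finset.sum_congr rfl fun k _ => ?_
    rw [← congrFun (congrFun hQt k) i, transpose_apply]
  have htr0 : 0 ≤ trace (Q * A * Q) := by
    rw [← htrace]
    exact Finset.sum_nonneg fun i _ => integral_nonneg fun ω => sq_nonneg _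
  have hq2 : MemLp (fun ω => Y ω ⬝ᵥ C *ᵥ Y ω) 2 P := by
    simp only [hquad]
    exact memLp_finsetSum _ fun i _ => memLp_sq_of_four (hL (Q i))
  have hqsq : ∫ ω, (Y ω ⬝ᵥ C *ᵥ Y ω) ^ 2 ∂P ≤ (K * trace (Q * A * Q)) ^ 2 := by
    simp only [hquad, ← htrace]
    exact integral_sum_sq_sq_le hK (fun i => hL (Q i)) fun i => h4 (Q i)
  set w : Fin d → ℝ := fun i => ∫ ω, (Y ω ⬝ᵥ C *ᵥ Y ω) * (R *ᵥ Y ω) i ∂P with hw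
  have hL2 : ∀ u : Fin d → ℝ, MemLp (fun ω => u ⬝ᵥ Y ω) 2 P := fun u =>
    (hL u).mono_exponent (by norm_num)
  have hww : w ⬝ᵥ w = ∫ ω, (Y ω ⬝ᵥ C *ᵥ Y ω) * ((R *ᵥ w) ⬝ᵥ Y ω) ∂P := by
    have h1 : ∀ ω, (Y ω ⬝ᵥ C *ᵥ Y ω) * ((R *ᵥ w) ⬝ᵥ Y ω) =
        ∑ i, w i * ((Y ω ⬝ᵥ C *ᵥ Y ω) * (R *ᵥ Y ω) i) := fun ω => by
      rw [dotProduct_comm (R *ᵥ w), dotProduct_mulVec (Y ω) R, ← mulVec_transpose R, hRt]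
      rw [dotProduct.eq_1 (R *ᵥ Y ω), Finset.mul_sum]
      exact Finset.sum_congr rfl fun i _ => by ring
    simp only [h1]
    have h2 : ∀ i, Integrable (fun ω => w i * ((Y ω ⬝ᵥ C *ᵥ Y ω) * (R *ᵥ Y ω) i)) P := fun i =>
      (hq2.integrable_mul (hL2 (R i))).const_mul _
    rw [integral_finsetSum _ fun i _ => h2 i]
    simp only [integral_const_mul]
    rfl
  have hcs : (w ⬝ᵥ w) ^ 2 ≤ (K * trace (Q * A * Q)) ^ 2 * (s * (w ⬝ᵥ w)) := by
    conv_lhs => rw [hww]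
    refine (sq_integral_mul_le hq2 (hL2 _)).trans ?_
    rw [integral_dotProduct_sq hL hA]
    exact mul_le_mul hqsq (dotProduct_sqrt_conj_mulVec_le hApos hB w)
      (by rw [← integral_dotProduct_sq hL hA]; exact integral_nonneg fun ω => sq_nonneg _)
      (sq_nonneg _)
  have hw2 : ∑ i, w i ^ 2 = w ⬝ᵥ w := by simp only [dotProduct, pow_two]
  have hle : w ⬝ᵥ w ≤ (K * trace (Q * A * Q)) ^ 2 * s := by
    have h0 : 0 ≤ w ⬝ᵥ w := by
      rw [← hw2]
      positivity
    rcases h0.eq_or_lt with h | h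
    · rw [← h]
      positivity
    · refine le_of_mul_le_mul_right ?_ h
      linarith
  rw [hw2]
  refine Real.sqrt_le_iff.2 ⟨by positivity, hle.trans_eq ?_⟩
  rw [mul_pow, mul_pow, mul_pow, Real.sq_sqrt hs0]
  ring

end Moments

namespace IsLogConcaveDensity

variable {d : ℕ} {p : EuclideanSpace ℝ (Fin d) → ℝ}

theorem ennLogConcave (hp : IsLogConcaveDensity p) :
    ENNLogConcave fun x => ENNReal.ofReal (p x) := by
  intro x y a b ha hb hab
  obtain rfl : b = 1 - a := by linarith
  simp only
  rw [ENNReal.ofReal_rpow_of_nonneg (hp.1 x) ha.le, ENNReal.ofReal_rpow_of_nonneg (hp.1 y) hb.le,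
    ← ENNReal.ofReal_mul (Real.rpow_nonneg (hp.1 x) a)]
  exact ENNReal.ofReal_le_ofReal (hp.2.2 x y a ⟨ha.le, by linarith⟩)

theorem isProbabilityMeasure (hp : IsLogConcaveDensity p) :
    IsProbabilityMeasure (volume.withDensity fun x => ENNReal.ofReal (p x)) := by
  refine ⟨?_⟩
  have hint : Integrable p := by
    by_contra h
    simpa [integral_undef h] using hp.2.1
  rw [withDensity_apply _ MeasurableSet.univ, Measure.restrict_univ,
    ← ofReal_integral_eq_lintegral_ofReal hint (ae_of_all _ hp.1), hp.2.1, ENNReal.ofReal_one]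

theorem integral_withDensity (hp : IsLogConcaveDensity p) {F : Type*} [NormedAddCommGroup F]
    [NormedSpace ℝ F] (f : EuclideanSpace ℝ (Fin d) → F) :
    ∫ x, f x ∂(volume.withDensity fun x => ENNReal.ofReal (p x)) = ∫ x, p x • f x := by
  rw [integral_withDensity_eq_integral_toReal_smul₀ hp.ennLogConcave.aemeasurable
    (ae_of_all _ fun x => ENNReal.ofReal_lt_top)]
  simp only [ENNReal.toReal_ofReal (hp.1 _)]

theorem ennLogConcave_tail (hp : IsLogConcaveDensity p) (u : Fin d → ℝ) (c : ℝ) :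
    ENNLogConcave fun t : ℝ => (volume.withDensity fun x => ENNReal.ofReal (p x))
      {x : EuclideanSpace ℝ (Fin d) | t < u ⬝ᵥ x + c} := by
  have hmeas : ∀ t, MeasurableSet {x : EuclideanSpace ℝ (Fin d) | t < u ⬝ᵥ x + c} := fun t =>
    measurableSet_lt measurable_const (by unfold dotProduct; fun_prop)
  have hjoint : ENNLogConcave fun q : ℝ × EuclideanSpace ℝ (Fin d) =>
      if q.1 < u ⬝ᵥ q.2 + c then ENNReal.ofReal (p q.2) else 0 := by
    rintro ⟨s, x⟩ ⟨t, y⟩ a b ha hb hab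
    by_cases hs : s < u ⬝ᵥ x + c
    · by_cases ht : t < u ⬝ᵥ y + c
      · have hst : a * s + b * t < u ⬝ᵥ (a • x + b • y : EuclideanSpace ℝ (Fin d)) + c := by
          have h1 : u ⬝ᵥ (a • x + b • y : EuclideanSpace ℝ (Fin d)) + c =
              a * (u ⬝ᵥ x + c) + b * (u ⬝ᵥ y + c) := by
            simp only [WithLp.ofLp_add, WithLp.ofLp_smul, dotProduct_add, dotProduct_smul,
              smul_eq_mul]
            linear_combination (-c) * hab
          rw [h1]
          gcongr
        simp only [Prod.smul_mk, Prod.mk_add_mk, smul_eq_mul]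
        rw [if_pos hs, if_pos ht, if_pos hst]
        exact hp.ennLogConcave x y a b ha hb hab
      · simp [ht, hb]
    · simp [hs, ha]
  convert hjoint.lintegral_euclidean using 2 with t
  rw [withDensity_apply _ (hmeas t), ← lintegral_indicator (hmeas t)]
  simp only [Set.indicator_apply, Set.mem_ofPred_eq]

section Marginals

variable (u : Fin d → ℝ) (c : ℝ)

theorem ennLogConcave_tail_neg (hp : IsLogConcaveDensity p) :
    ENNLogConcave fun t : ℝ => (volume.withDensity fun x => ENNReal.ofReal (p x))
      {x : EuclideanSpace ℝ (Fin d) | t < -(u ⬝ᵥ x + c)} := by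
  simpa only [neg_dotProduct, ← neg_add] using hp.ennLogConcave_tail (-u) (-c)

theorem measurable_marginal :
    Measurable fun x : EuclideanSpace ℝ (Fin d) => u ⬝ᵥ x + c := by
  unfold dotProduct
  fun_prop

theorem memLp_marginal (hp : IsLogConcaveDensity p) :
    MemLp (fun x : EuclideanSpace ℝ (Fin d) => u ⬝ᵥ x + c) 4
      (volume.withDensity fun x => ENNReal.ofReal (p x)) :=
  haveI := hp.isProbabilityMeasure
  LogConcaveTail.memLp_four (measurable_marginal u c) (hp.ennLogConcave_tail u c)
    (hp.ennLogConcave_tail_neg u c)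

theorem integrable_coord (hp : IsLogConcaveDensity p) (i : Fin d) :
    Integrable (fun x : EuclideanSpace ℝ (Fin d) => x i)
      (volume.withDensity fun x => ENNReal.ofReal (p x)) := by
  have := hp.isProbabilityMeasure
  simpa using (hp.memLp_marginal (Pi.single i 1) 0).integrable (by norm_num)

theorem densMean_apply (hp : IsLogConcaveDensity p) (i : Fin d) :
    densMean p i =
      ∫ x : EuclideanSpace ℝ (Fin d), x i ∂(volume.withDensity fun x => ENNReal.ofReal (p x)) := by
  have hid : Integrable (fun x : EuclideanSpace ℝ (Fin d) => x)
      (volume.withDensity fun x => ENNReal.ofReal (p x)) := by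
    refine (integrable_finsetSum Finset.univ fun j _ =>
      (hp.integrable_coord j).smul_const (EuclideanSpace.single j (1 : ℝ))).congr (ae_of_all _ fun x => ?_)
    ext k
    simp [Pi.single_apply]
  rw [densMean, ← hp.integral_withDensity fun x => x]
  exact ((EuclideanSpace.proj i : EuclideanSpace ℝ (Fin d) →L[ℝ] ℝ).integral_comp_comm hid).symm

theorem dotProduct_sub_densMean (x : EuclideanSpace ℝ (Fin d)) :
    (u ⬝ᵥ fun k => x k - densMean p k) = u ⬝ᵥ x + -(u ⬝ᵥ densMean p) := by
  rw [← sub_eq_add_neg, ← dotProduct_sub]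
  rfl

theorem integral_dotProduct_sub_densMean (hp : IsLogConcaveDensity p) :
    ∫ x : EuclideanSpace ℝ (Fin d), u ⬝ᵥ (fun k => x k - densMean p k)
      ∂(volume.withDensity fun x => ENNReal.ofReal (p x)) = 0 := by
  have := hp.isProbabilityMeasure
  have hcoord : ∀ j, Integrable (fun x : EuclideanSpace ℝ (Fin d) => x j - densMean p j)
      (volume.withDensity fun x => ENNReal.ofReal (p x)) := fun j =>
    (hp.integrable_coord j).sub (integrable_const _)
  simp only [dotProduct]
  rw [integral_finsetSum _ fun j _ => (hcoord j).const_mul _]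
  refine Finset.sum_eq_zero fun j _ => ?_
  rw [integral_const_mul, integral_sub (hp.integrable_coord j) (integrable_const _), ← hp.densMean_apply j]
  simp

theorem memLp_centered (hp : IsLogConcaveDensity p) :
    MemLp (fun x : EuclideanSpace ℝ (Fin d) => u ⬝ᵥ fun k => x k - densMean p k) 4
      (volume.withDensity fun x => ENNReal.ofReal (p x)) := by
  simpa only [dotProduct_sub_densMean] using hp.memLp_marginal u _

theorem fourth_moment_centered_le (hp : IsLogConcaveDensity p) :
    ∫ x : EuclideanSpace ℝ (Fin d), (u ⬝ᵥ fun k => x k - densMean p k) ^ 4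
      ∂(volume.withDensity fun x => ENNReal.ofReal (p x)) ≤
    (16 * ∫ x : EuclideanSpace ℝ (Fin d), (u ⬝ᵥ fun k => x k - densMean p k) ^ 2
      ∂(volume.withDensity fun x => ENNReal.ofReal (p x))) ^ 2 := by
  have := hp.isProbabilityMeasure
  have hmean := hp.integral_dotProduct_sub_densMean u
  simp only [dotProduct_sub_densMean] at hmean ⊢
  have h := LogConcaveTail.fourth_moment_le (measurable_marginal u _) (hp.ennLogConcave_tail u _)
    (hp.ennLogConcave_tail_neg u _) hmean
  rw [mul_pow]
  exact h.trans (mul_le_mul_of_nonneg_right (by norm_num) (sq_nonneg _))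

end Marginals

theorem covMatrix_apply (hp : IsLogConcaveDensity p) (i j : Fin d) :
    covMatrix p i j = ∫ x : EuclideanSpace ℝ (Fin d), (x i - densMean p i) * (x j - densMean p j)
      ∂(volume.withDensity fun x => ENNReal.ofReal (p x)) := by
  rw [hp.integral_withDensity]
  rfl

end IsLogConcaveDensity

/-- Lemma: tensor vector bound. -/
theorem tensor_vector_bound {d : ℕ} (p : EuclideanSpace ℝ (Fin d) → ℝ)
    (hp : IsLogConcaveDensity p) (B C : Matrix (Fin d) (Fin d) ℝ)
    (hB : B.PosSemidef) (hC : C.PosSemidef) :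
    Real.sqrt (∑ i, (∫ x : EuclideanSpace ℝ (Fin d),
        p x * ((((fun k => x k - densMean p k) ⬝ᵥ C.mulVec (fun k => x k - densMean p k))) *
          (matRpow B ((1 : ℝ) / 2)).mulVec (fun k => x k - densMean p k) i)) ^ 2)
      ≤ 16 * Real.sqrt (specNorm
            (matRpow (covMatrix p) ((1 : ℝ) / 2) * B * matRpow (covMatrix p) ((1 : ℝ) / 2))) *
          Matrix.trace
            (matRpow (covMatrix p) ((1 : ℝ) / 2) * C * matRpow (covMatrix p) ((1 : ℝ) / 2)) := by
  have := hp.isProbabilityMeasure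
  have h := sqrt_sum_integral_quadratic_mul_le (K := 16) (by norm_num) hp.memLp_centered
    hp.fourth_moment_centered_le hp.covMatrix_apply hB hC
  simpa only [hp.integral_withDensity, smul_eq_mul] using h
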